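/- arXiv:2108.01579 — 2 statements merged into one kernel-verified Lean document; each statement's English description precedes it below -/
import Mathlib

section
/- Let Λ = diag(λ₁, λ₂, …, λ_n) ∈ ℝ^{n×n} be a diagonal matrix and let Γ ∈ ℝ^{n} have no zero entries. Then the pair (Λ, Γ) is herdable if and only if for all indices i, j, the equality λ_i = λ_j implies [Γ]_i · [Γ]_j > 0 (i.e., the i-th and j-th entries of Γ have the same sign). -/
open Matrix

/-- The controllability matrix `[Γ | ΛΓ | ... | Λ^{n-1}Γ]` for a single-input pair `(Λ, Γ)`. -/
def ctrbMat {n : ℕ} (Λ : Matrix (Fin n) (Fin n) ℝ) (Γ : Fin n → ℝ) :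
    Matrix (Fin n) (Fin n) ℝ :=
  Matrix.of fun i k => (Λ ^ (k : ℕ)).mulVec Γ i

theorem ctrbMat_diagonal_mulVec {n : ℕ} (lam Γ u : Fin n → ℝ) (i : Fin n) :
    (ctrbMat (Matrix.diagonal lam) Γ).mulVec u i = Γ i * ∑ k : Fin n, u k * lam i ^ (k : ℕ) := by
  simp only [ctrbMat, Matrix.diagonal_pow, Matrix.mulVec, dotProduct,
    Matrix.of_apply, Matrix.diagonal_apply, Finset.mul_sum, ite_mul, zero_mul,
    Finset.sum_ite_eq, Finset.mem_univ, if_true, Pi.pow_apply]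
  exact Finset.sum_congr rfl fun k _ => by ring

/-- Real polynomials of degree less than `n` interpolate any function on `n` (possibly repeated)
points. -/
theorem exists_sum_mul_pow_eq {n : ℕ} (lam : Fin n → ℝ) (r : ℝ → ℝ) :
    ∃ u : Fin n → ℝ, ∀ i, ∑ k : Fin n, u k * lam i ^ (k : ℕ) = r (lam i) := by
  set s := Finset.univ.image lam
  set p := Lagrange.interpolate s id r
  have hs : s.card ≤ n := by simpa using (Finset.card_image_le : s.card ≤ _)
  have hp : p.degree < n :=
    (Lagrange.degree_interpolate_lt r (Set.injOn_id _)).trans_le (by exact_mod_cast hs)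
  refine ⟨fun k => p.coeff k, fun i => ?_⟩
  have hi : p.eval (lam i) = r (lam i) :=
    Lagrange.eval_interpolate_at_node r (Set.injOn_id _)
      (Finset.mem_image_of_mem lam (Finset.mem_univ i))
  rw [← hi, Polynomial.eval_eq_sum, ← Polynomial.sum_fin _ (by simp) hp]

theorem stmt16 {n : ℕ} (lam : Fin n → ℝ) (Γ : Fin n → ℝ)
    -- Γ has no zero entries
    (hΓ : ∀ i, Γ i ≠ 0) :
    -- (diag(λ₁,…,λ_n), Γ) is herdable iff λ_i = λ_j implies Γ_i and Γ_j have the same sign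
    ((∃ u : Fin n → ℝ, ∀ i, 0 < (ctrbMat (Matrix.diagonal lam) Γ).mulVec u i) ↔
      (∀ i j : Fin n, lam i = lam j → 0 < Γ i * Γ j)) := by
  simp only [ctrbMat_diagonal_mulVec]
  constructor
  · rintro ⟨u, hu⟩ i j hij
    have hi := hu i
    have hj := hu j
    rw [← hij] at hj
    have h := mul_pos hi hj
    rw [mul_mul_mul_comm] at h
    exact pos_of_mul_pos_left h (mul_self_nonneg _)
  · intro h
    obtain ⟨u, hu⟩ := exists_sum_mul_pow_eq lam fun x => ∑ j with lam j = x, Γ j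
    refine ⟨u, fun i => ?_⟩
    rw [hu, Finset.mul_sum]
    exact Finset.sum_pos (fun j hj => h i j (Finset.mem_filter.1 hj).2.symm) ⟨i, by simp⟩
end

section
/- Let Λ = diag(λ₁, λ₂, …, λ_n) ∈ ℝ^{n×n} be a diagonal matrix and Γ ∈ ℝ^{n}. For each μ in the set of distinct values among λ₁,…,λ_n, define the vector v_μ ∈ ℝ^n by [v_μ]_i = [Γ]_i if λ_i = μ, and [v_μ]_i = 0 otherwise. Then the image of the controllability matrix R(Λ, Γ) = [Γ | ΛΓ | Λ²Γ | ... | Λ^{n−1}Γ] equals the linear span of the vectors {v_μ : μ ∈ {λ₁,…,λ_n}}. -/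
open Matrix

theorem ctrbMat_diagonal_mulVec_apply {n : ℕ} (lam Γ c : Fin n → ℝ) (i : Fin n) :
    (ctrbMat (Matrix.diagonal lam) Γ).mulVec c i = (∑ k : Fin n, c k * lam i ^ (k : ℕ)) * Γ i := by
  simp only [ctrbMat, Matrix.mulVec, dotProduct, Matrix.of_apply, Matrix.diagonal_pow,
    Matrix.diagonal_apply, Pi.pow_apply, Finset.sum_mul, ite_mul, zero_mul, Finset.sum_ite_eq,
    Finset.mem_univ, if_true]
  exact Finset.sum_congr rfl fun k _ => by ring

/-- Any function is interpolated at `n` (possibly repeated) nodes by a polynomial of degree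
less than `n`. -/
theorem exists_coeff_sum_pow_eq {n : ℕ} (lam : Fin n → ℝ) (f : ℝ → ℝ) :
    ∃ c : Fin n → ℝ, ∀ i, ∑ k : Fin n, c k * lam i ^ (k : ℕ) = f (lam i) := by
  classical
  set s : Finset ℝ := Finset.univ.image lam
  set p := Lagrange.interpolate s id f
  have hs : s.card ≤ n := by simpa using Finset.card_image_le (s := Finset.univ) (f := lam)
  have hp : p.degree < n :=
    (Lagrange.degree_interpolate_lt f (Function.injective_id.injOn)).trans_le (by exact_mod_cast hs)
  refine ⟨fun k => p.coeff k, fun i => ?_⟩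
  have he : p.eval (lam i) = f (lam i) :=
    Lagrange.eval_interpolate_at_node (v := id) f Function.injective_id.injOn
      (Finset.mem_image_of_mem lam (Finset.mem_univ i))
  rw [← he, Polynomial.eval_eq_sum, ← Polynomial.sum_fin (fun k a => a * lam i ^ k) (by simp) hp]

theorem stmt17 {n : ℕ} (lam : Fin n → ℝ) (Γ : Fin n → ℝ)
    -- for each eigenvalue value μ, v_μ agrees with Γ on the indices i with λ_i = μ
    -- and vanishes elsewhere
    (v : ℝ → (Fin n → ℝ))
    (hv : ∀ (μ : ℝ) (i : Fin n), v μ i = if lam i = μ then Γ i else 0) :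
    -- Im R(Λ,Γ) is the span of the vectors v_μ for μ ranging over the values λ₁,…,λ_n
    Set.range (ctrbMat (Matrix.diagonal lam) Γ).mulVec =
      ↑(Submodule.span ℝ (Set.range fun i : Fin n => v (lam i))) := by
  classical
  rw [← Matrix.coe_mulVecLin, ← LinearMap.coe_range, SetLike.coe_set_eq]
  apply le_antisymm
  · rintro _ ⟨c, rfl⟩
    have h : (ctrbMat (Matrix.diagonal lam) Γ).mulVecLin c =
        ∑ μ ∈ Finset.univ.image lam, (∑ k : Fin n, c k * μ ^ (k : ℕ)) • v μ := by
      ext i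
      rw [Matrix.mulVecLin_apply, ctrbMat_diagonal_mulVec_apply]
      simp [hv]
    rw [h]
    refine Submodule.sum_mem _ fun μ hμ => Submodule.smul_mem _ _ (Submodule.subset_span ?_)
    obtain ⟨i, -, rfl⟩ := Finset.mem_image.mp hμ
    exact ⟨i, rfl⟩
  · rw [Submodule.span_le]
    rintro _ ⟨j, rfl⟩
    obtain ⟨c, hc⟩ := exists_coeff_sum_pow_eq lam fun x => if x = lam j then 1 else 0
    refine ⟨c, funext fun i => ?_⟩
    rw [Matrix.mulVecLin_apply, ctrbMat_diagonal_mulVec_apply, hc]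
    simp [hv]
end
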